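/- arXiv:0705.4279 — 5 statements merged into one kernel-verified Lean document; each statement's English description precedes it below -/
import Mathlib

section
/- Let S be a finite semilattice. Then the semigroup algebra ℓ¹(S) has a multiplicative identity u = ∑_{p∈S} u(p) δ_p, whose coefficients satisfy u(p) = 1 − ∑_{t > p} u(t) for every p ∈ S (an empty sum being 0); moreover ∑_{s∈S} u(s) = 1. -/
open scoped Classical

/-- A function on a finite partial order is determined by its sums over principal up-sets. -/
theorem eq_of_forall_sum_le_eq {P M : Type*} [Fintype P] [PartialOrder P] [AddCommGroup M]
    {f g : P → M} (h : ∀ p, ∑ t with p ≤ t, f t = ∑ t with p ≤ t, g t) : f = g := by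
  funext p
  induction p using WellFoundedGT.induction with
  | ind p ih =>
    have hp : p ∈ Finset.univ.filter (p ≤ ·) := by simp
    have key := h p
    rw [← Finset.add_sum_erase _ f hp, ← Finset.add_sum_erase _ g hp] at key
    rw [Finset.sum_congr rfl fun t ht => ih t ?_] at key
    · exact add_right_cancel key
    · simp only [Finset.mem_erase, Finset.mem_filter] at ht
      exact lt_of_le_of_ne ht.2.2 (Ne.symm ht.1)

/-- Every function on a finite partial order arises by summing over principal up-sets. -/
theorem exists_forall_sum_le_eq {P K : Type*} [Fintype P] [PartialOrder P] [Field K]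
    (g : P → K) : ∃ f : P → K, ∀ p, ∑ t with p ≤ t, f t = g p := by
  let L : (P → K) →ₗ[K] (P → K) :=
    LinearMap.pi fun p => ∑ t with p ≤ t, LinearMap.proj t
  have hL : ∀ f p, L f p = ∑ t with p ≤ t, f t := fun f p => by simp [L]
  have hinj : Function.Injective L := fun f f' hff' =>
    eq_of_forall_sum_le_eq fun p => by rw [← hL, ← hL, hff']
  obtain ⟨f, hf⟩ := LinearMap.injective_iff_surjective.mp hinj g
  exact ⟨f, fun p => by rw [← hL, hf]⟩

/-- If the coefficients `u` sum to `1` over every principal up-set of a finite meet-semilattice,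
then their sum over the fibre of `p ↦ p ⊓ a` above `b` is `1` if `b = a` and `0` otherwise. -/
theorem sum_inf_eq_of_sum_le_eq_one {P K : Type*} [Fintype P] [SemilatticeInf P] [Field K]
    {u : P → K} (hu : ∀ p, ∑ t with p ≤ t, u t = 1) (a b : P) :
    ∑ p with p ⊓ a = b, u p = if b = a then 1 else 0 := by
  suffices h : (fun b => ∑ p with p ⊓ a = b, u p) = fun b => if b = a then 1 else 0 from
    congrFun h b
  refine eq_of_forall_sum_le_eq fun b => ?_
  have hfib : ∑ t with b ≤ t, ∑ p with p ⊓ a = t, u p = ∑ p with b ≤ p ⊓ a, u p := by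
    simp only [Finset.sum_filter]
    simp_rw [← Finset.sum_filter (fun t => b ≤ t), Finset.sum_comm (s := Finset.univ.filter _)]
    simp
  rw [hfib]
  by_cases hba : b ≤ a
  · simp [hba, hu]
  · simp [hba]

/-- The meet-semilattice structure of a commutative semigroup of idempotents, ordered by
`a ≤ b ↔ a * b = a`. -/
abbrev CommSemigroup.toSemilatticeInf {S : Type*} [CommSemigroup S]
    (hidem : ∀ s : S, s * s = s) : SemilatticeInf S where
  le a b := a * b = a
  le_refl := hidem
  le_trans a b c hab hbc := by
    rw [← hab, mul_assoc, hbc]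
  le_antisymm a b hab hba := by rw [← hab, mul_comm, hba]
  inf a b := a * b
  inf_le_left a b := by
    rw [mul_right_comm, hidem]
  inf_le_right a b := by
    rw [mul_assoc, hidem]
  le_inf a b c hab hac := by
    rw [← mul_assoc, hab, hac]

/-- **Proposition (unit of a finite semilattice algebra).**
If `S` is a finite semilattice (a nonempty finite commutative semigroup of
idempotents, partially ordered by `s ≤ t ↔ s * t = s`), then the semigroup
algebra `ℓ¹(S) = MonoidAlgebra ℂ S` has a multiplicative identity
`u = ∑_{p ∈ S} u(p) δ_p`, whose coefficients satisfy
`u(p) = 1 − ∑_{t > p} u(t)` for every `p`, and moreover `∑_{s ∈ S} u(s) = 1`. -/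
theorem semilattice_algebra_unit (S : Type) [Fintype S] [Nonempty S]
    [CommSemigroup S] (hidem : ∀ s : S, s * s = s) :
    ∃ u : S → ℂ,
      (∀ x : MonoidAlgebra ℂ S,
          (∑ p : S, u p • MonoidAlgebra.single p (1 : ℂ)) * x = x ∧
          x * (∑ p : S, u p • MonoidAlgebra.single p (1 : ℂ)) = x) ∧
      (∀ p : S,
          u p = 1 - ∑ t ∈ Finset.univ.filter fun t : S => p * t = p ∧ t ≠ p, u t) ∧
      (∑ s : S, u s = 1) := by
  let _ : SemilatticeInf S := CommSemigroup.toSemilatticeInf hidem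
  obtain ⟨u, hu⟩ := exists_forall_sum_le_eq (P := S) (fun _ => (1 : ℂ))
  have hfib (a b : S) : ∑ p with p * a = b, u p = if b = a then 1 else 0 :=
    sum_inf_eq_of_sum_le_eq_one hu a b
  have hleft (x : MonoidAlgebra ℂ S) :
      (∑ p : S, u p • MonoidAlgebra.single p (1 : ℂ)) * x = x := by
    induction x using MonoidAlgebra.induction_linear with
    | zero => simp
    | add x y hx hy => rw [mul_add, hx, hy]
    | single a c =>
      ext b
      have h := congrArg (· * c) (hfib a b)
      simp only [Finset.sum_filter, Finset.sum_mul, ite_mul, zero_mul, one_mul] at h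
      simpa [Finset.sum_mul, MonoidAlgebra.single_mul_single,
        Finsupp.single_apply, ← ite_and, eq_comm] using h
  refine ⟨u, fun x => ⟨hleft x, by rw [mul_comm, hleft]⟩, fun p => ?_, ?_⟩
  · have hp : p ∈ Finset.univ.filter fun t : S => p * t = p := by simp [hidem]
    have h : ∑ t with p * t = p, u t = 1 := hu p
    rw [← Finset.add_sum_erase _ u hp] at h
    rw [← h, eq_sub_iff_add_eq]
    congr 2
    ext t
    simp [and_comm]
  · obtain ⟨a⟩ := ‹Nonempty S›
    rw [← Finset.sum_fiberwise Finset.univ (· * a) u]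
    simp [hfib]
end

section
/- Let S be a finite semilattice. Then the semigroup algebra ℓ¹(S) possesses a diagonal, and this diagonal is unique; that is, there is exactly one element D ∈ ℓ¹(S) ⊗ ℓ¹(S) satisfying a·m(D) = a = m(D)·a and a·D = D·a for all a ∈ ℓ¹(S). -/
open scoped TensorProduct

/-- `D ∈ A ⊗ A` is a *diagonal* for the (possibly non-unital) algebra `A`:
`a·m(D) = a = m(D)·a` and `a·D = D·a` for every `a ∈ A`. -/
def IsDiagonal {A : Type*} [NonUnitalSemiring A] [Module ℂ A]
    [SMulCommClass ℂ A A] [IsScalarTower ℂ A A] (D : A ⊗[ℂ] A) : Prop :=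
  (∀ a : A, a * LinearMap.mul' ℂ A D = a ∧ LinearMap.mul' ℂ A D * a = a) ∧
  (∀ a : A, TensorProduct.map (LinearMap.mulLeft ℂ a) LinearMap.id D =
            TensorProduct.map LinearMap.id (LinearMap.mulRight ℂ a) D)

section Uniqueness

variable {A : Type*} [NonUnitalCommRing A] [Module ℂ A] [SMulCommClass ℂ A A]
  [IsScalarTower ℂ A A]

/-- For a diagonal `D` of a commutative algebra, multiplication by `x` in `A ⊗ A` sends `D` to
the multiple of `D` by `m(x)` in the second factor. -/
theorem IsDiagonal.mul_eq_map_mulLeft {D : A ⊗[ℂ] A} (hD : IsDiagonal D) (x : A ⊗[ℂ] A) :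
    x * D = TensorProduct.map LinearMap.id (LinearMap.mulLeft ℂ (LinearMap.mul' ℂ A x)) D := by
  induction x with
  | zero => simp
  | add x y hx hy =>
    rw [add_mul, hx, hy, map_add, ← LinearMap.add_apply, ← TensorProduct.map_add_right]
    congr 2
    ext z
    simp [add_mul]
  | tmul a b =>
    have left_action : ∀ z : A ⊗[ℂ] A, a ⊗ₜ[ℂ] b * z =
        TensorProduct.map LinearMap.id (LinearMap.mulLeft ℂ b)
          (TensorProduct.map (LinearMap.mulLeft ℂ a) LinearMap.id z) := by
      intro z
      induction z with
      | zero => simp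
      | add x y hx hy => simp only [mul_add, map_add, hx, hy]
      | tmul c d => simp
    rw [left_action, hD.2 a, ← LinearMap.comp_apply, ← TensorProduct.map_comp]
    congr 2
    ext z
    simp only [LinearMap.comp_apply, LinearMap.mulLeft_apply, LinearMap.mulRight_apply,
      LinearMap.mul'_apply]
    rw [mul_comm z a, ← mul_assoc, mul_comm b a]

theorem IsDiagonal.mul_eq_right {D E : A ⊗[ℂ] A} (hD : IsDiagonal D) (hE : IsDiagonal E) :
    E * D = D := by
  have mulLeft_eq_id : LinearMap.mulLeft ℂ (LinearMap.mul' ℂ A E) = LinearMap.id := by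
    ext z
    exact (hE.1 z).2
  rw [hD.mul_eq_map_mulLeft, mulLeft_eq_id, TensorProduct.map_id, LinearMap.id_apply]

theorem tensor_mul_comm (x y : A ⊗[ℂ] A) : x * y = y * x := by
  induction x with
  | zero => simp
  | add x z hx hz => rw [add_mul, mul_add, hx, hz]
  | tmul a b =>
    induction y with
    | zero => simp
    | add y z hy hz => rw [add_mul, mul_add, hy, hz]
    | tmul c d =>
      rw [Algebra.TensorProduct.tmul_mul_tmul, Algebra.TensorProduct.tmul_mul_tmul,
        mul_comm a, mul_comm b]

/-- A commutative algebra has at most one diagonal. -/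
theorem IsDiagonal.eq {D E : A ⊗[ℂ] A} (hD : IsDiagonal D) (hE : IsDiagonal E) : D = E := by
  rw [← hD.mul_eq_right hE, tensor_mul_comm, hE.mul_eq_right hD]

end Uniqueness

/-- An algebra isomorphic to `ℂ ^ ι`, with `ι` finite, has a diagonal. -/
theorem exists_isDiagonal_of_bijective {A ι : Type*} [NonUnitalSemiring A] [Module ℂ A]
    [SMulCommClass ℂ A A] [IsScalarTower ℂ A A] [Fintype ι] (f : A →ₙₐ[ℂ] (ι → ℂ))
    (hf : Function.Bijective f) : ∃ D : A ⊗[ℂ] A, IsDiagonal D := by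
  classical
  choose e he using fun i => hf.2 (Pi.single i 1)
  have mul_e : ∀ a i, a * e i = f a i • e i := by
    intro a i
    apply hf.1
    rw [map_mul, map_smul, he]
    ext j
    by_cases hij : j = i
    · subst hij; simp
    · simp [hij]
  have e_mul : ∀ a i, e i * a = f a i • e i := by
    intro a i
    rw [← mul_e]
    apply hf.1
    rw [map_mul, map_mul, mul_comm]
  have map_sum_e : f (∑ i, e i) = 1 := by
    rw [map_sum]
    simp only [he]
    exact Finset.univ_sum_single (1 : ι → ℂ)
  have mul'_sum : LinearMap.mul' ℂ A (∑ i, e i ⊗ₜ[ℂ] e i) = ∑ i, e i := by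
    rw [map_sum]
    refine Finset.sum_congr rfl fun i _ => ?_
    rw [LinearMap.mul'_apply, mul_e, he, Pi.single_eq_same, one_smul]
  refine ⟨∑ i, e i ⊗ₜ[ℂ] e i, fun a => ⟨?_, ?_⟩, fun a => ?_⟩
  · apply hf.1
    rw [mul'_sum, map_mul, map_sum_e, mul_one]
  · apply hf.1
    rw [mul'_sum, map_mul, map_sum_e, one_mul]
  · simp only [map_sum, TensorProduct.map_tmul, LinearMap.mulLeft_apply,
      LinearMap.mulRight_apply, LinearMap.id_apply, mul_e, e_mul, TensorProduct.smul_tmul]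

section Semilattice

variable {S : Type*} [CommSemigroup S]

/-- In a semilattice, an element lies below a product iff it lies below both factors. -/
theorem mul_mul_eq_left_iff (hidem : ∀ s : S, s * s = s) (s t u : S) :
    s * (t * u) = s ↔ s * t = s ∧ s * u = s := by
  constructor
  · intro h
    constructor
    · calc s * t = s * (t * u) * t := by rw [h]
        _ = s * (t * t * u) := by ac_rfl
        _ = s := by rw [hidem, h]
    · calc s * u = s * (t * u) * u := by rw [h]
        _ = s * (t * (u * u)) := by ac_rfl
        _ = s := by rw [hidem, h]
  · rintro ⟨ht, hu⟩
    rw [← mul_assoc, ht, hu]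

/-- The partial order of a semilattice: `s ≤ t` iff `s * t = s`. -/
abbrev semilatticePartialOrder (hidem : ∀ s : S, s * s = s) : PartialOrder S where
  le s t := s * t = s
  le_refl := hidem
  le_trans s t u hst htu := by rw [← hst, mul_assoc, htu]
  le_antisymm s t hst hts := by rw [← hst, mul_comm, hts]

open Classical in
/-- The algebra homomorphism sending `δ_t` to the indicator function of `{s | s ≤ t}`. -/
noncomputable def semilatticeTransform (hidem : ∀ s : S, s * s = s) :
    MonoidAlgebra ℂ S →ₙₐ[ℂ] (S → ℂ) :=
  MonoidAlgebra.liftMagma ℂ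
    { toFun := fun t s => if s * t = s then 1 else 0
      map_mul' := fun t u => by
        ext s
        simp only [Pi.mul_apply, mul_mul_eq_left_iff hidem, ite_and, ite_mul, one_mul, zero_mul] }

open Classical in
theorem semilatticeTransform_apply (hidem : ∀ s : S, s * s = s) (x : MonoidAlgebra ℂ S) (s : S) :
    semilatticeTransform hidem x s = x.coeff.sum fun t c => if s * t = s then c else 0 := by
  simp [semilatticeTransform, MonoidAlgebra.liftMagma_apply_apply, Finsupp.sum]

theorem semilatticeTransform_injective (hidem : ∀ s : S, s * s = s) :
    Function.Injective (semilatticeTransform hidem) := by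
  classical
  let := semilatticePartialOrder hidem
  rw [injective_iff_map_eq_zero]
  intro x hx
  by_contra hne
  obtain ⟨s, hs⟩ := x.coeff.support.exists_maximal
    (Finsupp.support_nonempty_iff.mpr (MonoidAlgebra.coeff_eq_zero.not.mpr hne))
  have hval := congrFun hx s
  rw [semilatticeTransform_apply, Finsupp.sum, Finset.sum_eq_single s] at hval
  · rw [if_pos (hidem s)] at hval
    exact Finsupp.mem_support_iff.mp hs.1 hval
  · intro t ht hts
    exact if_neg fun hle => hts (hs.eq_of_le ht hle).symm
  · exact fun h => absurd hs.1 h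

theorem semilatticeTransform_bijective [Fintype S] (hidem : ∀ s : S, s * s = s) :
    Function.Bijective (semilatticeTransform hidem) := by
  refine ⟨semilatticeTransform_injective hidem, ?_⟩
  have finrank_eq : Module.finrank ℂ (MonoidAlgebra ℂ S) = Module.finrank ℂ (S → ℂ) :=
    ((MonoidAlgebra.coeffLinearEquiv ℂ).trans (Finsupp.linearEquivFunOnFinite ℂ ℂ S)).finrank_eq
  exact (LinearMap.injective_iff_surjective_of_finrank_eq_finrank
    (f := (semilatticeTransform hidem : MonoidAlgebra ℂ S →ₗ[ℂ] (S → ℂ))) finrank_eq).mp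
    (semilatticeTransform_injective hidem)

end Semilattice

/-- **Existence and uniqueness of the diagonal of a finite semilattice algebra.**
For every finite semilattice `S`, the semigroup algebra `ℓ¹(S) = MonoidAlgebra ℂ S`
possesses exactly one diagonal. -/
theorem semilattice_algebra_exists_unique_diagonal (S : Type) [Fintype S] [Nonempty S]
    [CommSemigroup S] (hidem : ∀ s : S, s * s = s) :
    ∃! D : MonoidAlgebra ℂ S ⊗[ℂ] MonoidAlgebra ℂ S, IsDiagonal D := by
  obtain ⟨D, hD⟩ := exists_isDiagonal_of_bijective (semilatticeTransform hidem)
    (semilatticeTransform_bijective hidem)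
  exact ⟨D, hD, fun E hE => IsDiagonal.eq hE hD⟩
end

section
/- Let S be a finite semilattice with unique diagonal D = ∑_{(s,t)∈S×S} d(s,t) δ_s ⊗ δ_t. If p, q ∈ S and q is not ≥ p (i.e. ¬(p ≤ q)), then ∑_{t ≥ q} d(p,t) = 0 and ∑_{s ≥ q} d(s,p) = 0; equivalently d(p,q) = −∑_{t > q} d(p,t) and d(q,p) = −∑_{s > q} d(s,p). -/
open scoped TensorProduct Classical

/-- Comparing coefficients of `δ_p ⊗ δ_q` on both sides of `δ_a · D = D · δ_a`. -/
theorem IsDiagonal.sum_coeff_eq {S : Type*} [Fintype S] [Semigroup S] {d : S × S → ℂ}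
    (hD : IsDiagonal (∑ x : S × S, d x •
      (MonoidAlgebra.single x.1 (1 : ℂ) ⊗ₜ[ℂ] MonoidAlgebra.single x.2 (1 : ℂ)))) (a p q : S) :
    ∑ s with a * s = p, d (s, q) = ∑ t with t * a = q, d (p, t) := by
  let coeffAt (r : S) : MonoidAlgebra ℂ S →ₗ[ℂ] ℂ :=
    Finsupp.lapply r ∘ₗ (MonoidAlgebra.coeffLinearEquiv ℂ).toLinearMap
  have h := congrArg (fun x => LinearMap.mul' ℂ ℂ (TensorProduct.map (coeffAt p) (coeffAt q) x))
    (hD.2 (MonoidAlgebra.single a 1))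
  simp only [map_sum, map_smul, TensorProduct.map_tmul, LinearMap.mulLeft_apply,
    LinearMap.mulRight_apply, LinearMap.id_apply, MonoidAlgebra.single_mul_single] at h
  rw [Fintype.sum_prod_type, Fintype.sum_prod_type_right] at h
  simpa [coeffAt, Finsupp.single_apply, Finset.sum_filter] using h

/-- **Lemma (off-order diagonal coefficients).**
Let `S` be a finite semilattice (ordered by `s ≤ t ↔ s * t = s`) and let
`D = ∑_{(s,t)} d(s,t) δ_s ⊗ δ_t` be the (unique) diagonal of `ℓ¹(S)`.
If `p, q ∈ S` with `¬(p ≤ q)`, then `∑_{t ≥ q} d(p,t) = 0` and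
`∑_{s ≥ q} d(s,p) = 0`; equivalently `d(p,q) = −∑_{t > q} d(p,t)` and
`d(q,p) = −∑_{s > q} d(s,p)`. -/
theorem diagonal_coeff_off_diag (S : Type) [Fintype S] [Nonempty S]
    [CommSemigroup S] (hidem : ∀ s : S, s * s = s)
    (d : S × S → ℂ)
    (D : MonoidAlgebra ℂ S ⊗[ℂ] MonoidAlgebra ℂ S)
    (hD : IsDiagonal D)
    (hDd : D = ∑ q : S × S,
        d q • (MonoidAlgebra.single q.1 (1 : ℂ) ⊗ₜ[ℂ] MonoidAlgebra.single q.2 (1 : ℂ))) :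
    ∀ p q : S, ¬ p * q = p →
      ((∑ t ∈ Finset.univ.filter fun t : S => q * t = q, d (p, t)) = 0 ∧
       (∑ s ∈ Finset.univ.filter fun s : S => q * s = q, d (s, p)) = 0) ∧
      (d (p, q) = -∑ t ∈ Finset.univ.filter fun t : S => q * t = q ∧ t ≠ q, d (p, t)) ∧
      (d (q, p) = -∑ s ∈ Finset.univ.filter fun s : S => q * s = q ∧ s ≠ q, d (s, p)) := by
  subst hDd
  intro p q hpq
  have not_mul_eq (s : S) : q * s ≠ p := by
    rintro rfl
    apply hpq
    rw [mul_comm, ← mul_assoc, hidem]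
  have right_sum : ∑ t with q * t = q, d (p, t) = 0 := by
    have h := hD.sum_coeff_eq q p q
    simpa [not_mul_eq, mul_comm _ q] using h.symm
  have left_sum : ∑ s with q * s = q, d (s, p) = 0 := by
    have h := hD.sum_coeff_eq q q p
    simpa [not_mul_eq, mul_comm _ q] using h
  have split_sum (f : S → ℂ) :
      ∑ t with q * t = q, f t = f q + ∑ t with q * t = q ∧ t ≠ q, f t := by
    rw [← Finset.add_sum_erase _ f (a := q) (by simp [hidem])]
    congr 2
    ext t
    simp [and_comm]
  refine ⟨⟨right_sum, left_sum⟩, eq_neg_of_add_eq_zero_left ?_, eq_neg_of_add_eq_zero_left ?_⟩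
  · rw [← split_sum fun t => d (p, t), right_sum]
  · rw [← split_sum fun s => d (s, p), left_sum]
end

section
/- Let S be a finite semilattice with unique diagonal D = ∑_{(s,t)∈S×S} d(s,t) δ_s ⊗ δ_t. Then every coefficient d(p,q) is an integer; moreover, for every maximal element p of S one has d(p,p) = 1, and for distinct maximal elements p, q of S one has d(p,q) = 0. -/
open scoped TensorProduct Classical

/-- Evaluation of the tensor `φ ⊗ ψ` of two characters of `A` on `A ⊗ A`. -/
noncomputable def charTensor {A : Type*} [NonUnitalSemiring A] [Module ℂ A]
    (φ ψ : A →ₙₐ[ℂ] ℂ) : A ⊗[ℂ] A →ₗ[ℂ] ℂ :=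
  LinearMap.mul' ℂ ℂ ∘ₗ TensorProduct.map (φ : A →ₗ[ℂ] ℂ) (ψ : A →ₗ[ℂ] ℂ)

@[simp]
lemma charTensor_tmul {A : Type*} [NonUnitalSemiring A] [Module ℂ A]
    (φ ψ : A →ₙₐ[ℂ] ℂ) (a b : A) : charTensor φ ψ (a ⊗ₜ[ℂ] b) = φ a * ψ b := by
  simp [charTensor]

section IsDiagonal

variable {A : Type*} [NonUnitalSemiring A] [Module ℂ A]

lemma charTensor_self [SMulCommClass ℂ A A] [IsScalarTower ℂ A A] (φ : A →ₙₐ[ℂ] ℂ) (D : A ⊗[ℂ] A) :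
    charTensor φ φ D = φ (LinearMap.mul' ℂ A D) := by
  induction D with
  | zero => simp
  | tmul a b => simp
  | add x y hx hy => simp [hx, hy]

lemma charTensor_mulLeft [SMulCommClass ℂ A A] (φ ψ : A →ₙₐ[ℂ] ℂ) (a : A) (D : A ⊗[ℂ] A) :
    charTensor φ ψ (TensorProduct.map (LinearMap.mulLeft ℂ a) LinearMap.id D) =
      φ a * charTensor φ ψ D := by
  induction D with
  | zero => simp
  | tmul b c => simp [mul_assoc]
  | add x y hx hy => simp [hx, hy, mul_add]

lemma charTensor_mulRight [IsScalarTower ℂ A A] (φ ψ : A →ₙₐ[ℂ] ℂ) (a : A) (D : A ⊗[ℂ] A) :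
    charTensor φ ψ (TensorProduct.map LinearMap.id (LinearMap.mulRight ℂ a) D) =
      ψ a * charTensor φ ψ D := by
  induction D with
  | zero => simp
  | tmul b c => simp only [TensorProduct.map_tmul, LinearMap.id_apply,
      LinearMap.mulRight_apply, charTensor_tmul, map_mul]; ring
  | add x y hx hy => simp [hx, hy, mul_add]

variable [SMulCommClass ℂ A A] [IsScalarTower ℂ A A]

lemma IsDiagonal.charTensor_self_eq_one {D : A ⊗[ℂ] A} (hD : IsDiagonal D)
    (φ : A →ₙₐ[ℂ] ℂ) {a : A} (ha : φ a ≠ 0) : charTensor φ φ D = 1 := by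
  have h := congrArg φ (hD.1 a).1
  rw [map_mul, ← charTensor_self] at h
  exact mul_left_cancel₀ ha (h.trans (mul_one _).symm)

lemma IsDiagonal.charTensor_eq_zero {D : A ⊗[ℂ] A} (hD : IsDiagonal D)
    (φ ψ : A →ₙₐ[ℂ] ℂ) {a : A} (ha : φ a ≠ ψ a) : charTensor φ ψ D = 0 := by
  have h := congrArg (charTensor φ ψ) (hD.2 a)
  rw [charTensor_mulLeft, charTensor_mulRight] at h
  by_contra h0
  exact ha (mul_right_cancel₀ h0 h)

end IsDiagonal

/-- The partial order of a semilattice: `s ≤ t` iff `s * t = s`. -/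
abbrev semilatticeOrder {S : Type*} [CommSemigroup S] (hidem : ∀ s : S, s * s = s) :
    PartialOrder S where
  le s t := s * t = s
  le_refl := hidem
  le_trans a b c hab hbc := by
    change a * b = a at hab
    change b * c = b at hbc
    rw [← hab, mul_assoc, hbc]
  le_antisymm a b hab hba := by
    change a * b = a at hab
    change b * a = b at hba
    rw [← hab, mul_comm, hba]

/-- The indicator of the up-set of `e` in a semilattice, as a multiplicative map. -/
noncomputable def upIndicator {S : Type*} [CommSemigroup S] (hidem : ∀ s : S, s * s = s) (e : S) :
    S →ₙ* ℂ where
  toFun s := if e * s = e then 1 else 0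
  map_mul' s t := by
    have key : e * (s * t) = e ↔ e * s = e ∧ e * t = e := by
      refine ⟨fun h => ⟨?_, ?_⟩, fun h => by rw [← mul_assoc, h.1, h.2]⟩
      · rw [← h, mul_assoc, mul_right_comm s t s, hidem]
      · rw [← h, mul_assoc, mul_assoc s t t, hidem]
    simp only [key, ite_and, mul_ite, mul_one, mul_zero]
    split_ifs <;> rfl

/-- The character of `ℓ¹(S)` given by the indicator of the up-set of `e`. -/
noncomputable def upChar {S : Type*} [CommSemigroup S] (hidem : ∀ s : S, s * s = s) (e : S) :
    MonoidAlgebra ℂ S →ₙₐ[ℂ] ℂ :=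
  MonoidAlgebra.liftMagma ℂ (upIndicator hidem e)

@[simp]
lemma upChar_single {S : Type*} [CommSemigroup S] (hidem : ∀ s : S, s * s = s) (e s : S) :
    upChar hidem e (MonoidAlgebra.single s 1) = if e * s = e then 1 else 0 := by
  simp [upChar, upIndicator]

/-- The sums of the diagonal coefficients over principal up-sets of `S × S`. -/
lemma IsDiagonal.sum_upset_coeff {S : Type*} [Fintype S] [CommSemigroup S]
    (hidem : ∀ s : S, s * s = s) {d : S × S → ℂ}
    (hD : IsDiagonal (∑ q : S × S,
      d q • (MonoidAlgebra.single q.1 (1 : ℂ) ⊗ₜ[ℂ] MonoidAlgebra.single q.2 (1 : ℂ))))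
    (e f : S) :
    ∑ x : S × S with e * x.1 = e ∧ f * x.2 = f, d x = if e = f then 1 else 0 := by
  trans charTensor (upChar hidem e) (upChar hidem f) (∑ q : S × S,
      d q • (MonoidAlgebra.single q.1 (1 : ℂ) ⊗ₜ[ℂ] MonoidAlgebra.single q.2 (1 : ℂ)))
  · rw [map_sum, Finset.sum_filter]
    refine Finset.sum_congr rfl fun x _ => ?_
    simp only [map_smul, charTensor_tmul, upChar_single, smul_eq_mul, ite_and, mul_ite, mul_one,
      mul_zero]
    split_ifs <;> rfl
  · split_ifs with hef
    · subst hef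
      exact hD.charTensor_self_eq_one _ (a := MonoidAlgebra.single e 1) (by simp [hidem])
    · by_cases hfe : f * e = f
      · have hne : e * f ≠ e := fun h => hef (h.symm.trans ((mul_comm e f).trans hfe))
        exact hD.charTensor_eq_zero _ _ (a := MonoidAlgebra.single f 1) (by simp [hidem, hne])
      · exact hD.charTensor_eq_zero _ _ (a := MonoidAlgebra.single e 1) (by simp [hidem, hfe])

/-- The coefficient at a pair of maximal elements. -/
lemma IsDiagonal.coeff_of_maximal {S : Type*} [Fintype S] [CommSemigroup S]
    (hidem : ∀ s : S, s * s = s) {d : S × S → ℂ}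
    (hD : IsDiagonal (∑ q : S × S,
      d q • (MonoidAlgebra.single q.1 (1 : ℂ) ⊗ₜ[ℂ] MonoidAlgebra.single q.2 (1 : ℂ))))
    {p q : S} (hp : ∀ t : S, p * t = p → t = p) (hq : ∀ t : S, q * t = q → t = q) :
    d (p, q) = if p = q then 1 else 0 := by
  rw [← hD.sum_upset_coeff hidem p q]
  have : Finset.univ.filter (fun x : S × S => p * x.1 = p ∧ q * x.2 = q) = {(p, q)} := by
    ext ⟨s, t⟩
    simp only [Finset.mem_filter, Finset.mem_univ, true_and, Finset.mem_singleton, Prod.mk.injEq]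
    refine ⟨fun h => ⟨hp s h.1, hq t h.2⟩, ?_⟩
    rintro ⟨rfl, rfl⟩
    exact ⟨hidem _, hidem _⟩
  rw [this, Finset.sum_singleton]

/-- If all sums of `f` over principal up-sets of a finite partial order lie in a subgroup, then so
do all values of `f`. -/
lemma mem_of_sum_upset_mem {P G : Type*} [Fintype P] [PartialOrder P] [AddCommGroup G]
    (H : AddSubgroup G) (f : P → G) (hf : ∀ x, ∑ y with x ≤ y, f y ∈ H) (x : P) : f x ∈ H := by
  induction x using WellFoundedGT.induction with
  | ind x ih =>
    have hx : x ∈ Finset.univ.filter (x ≤ ·) := by simp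
    have h := hf x
    rw [← Finset.add_sum_erase _ _ hx] at h
    refine (AddSubgroup.add_mem_cancel_right H (AddSubgroup.sum_mem H fun y hy => ih y ?_)).1 h
    simp only [Finset.mem_erase, Finset.mem_filter, Finset.mem_univ, true_and] at hy
    exact lt_of_le_of_ne hy.2 (Ne.symm hy.1)

/-- **Lemma (integrality of diagonal coefficients; maximal elements).**
Let `S` be a finite semilattice (ordered by `s ≤ t ↔ s * t = s`) and let
`D = ∑_{(s,t)} d(s,t) δ_s ⊗ δ_t` be the (unique) diagonal of `ℓ¹(S)`.
Then every `d(p,q)` is an integer; moreover `d(p,p) = 1` for each maximal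
element `p` of `S`, and `d(p,q) = 0` for distinct maximal elements `p, q`. -/
theorem diagonal_coeff_integer_and_maximal (S : Type) [Fintype S] [Nonempty S]
    [CommSemigroup S] (hidem : ∀ s : S, s * s = s)
    (d : S × S → ℂ)
    (D : MonoidAlgebra ℂ S ⊗[ℂ] MonoidAlgebra ℂ S)
    (hD : IsDiagonal D)
    (hDd : D = ∑ q : S × S,
        d q • (MonoidAlgebra.single q.1 (1 : ℂ) ⊗ₜ[ℂ] MonoidAlgebra.single q.2 (1 : ℂ))) :
    (∀ p q : S, ∃ k : ℤ, d (p, q) = (k : ℂ)) ∧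
    (∀ p : S, (∀ t : S, p * t = p → t = p) → d (p, p) = 1) ∧
    (∀ p q : S, (∀ t : S, p * t = p → t = p) → (∀ t : S, q * t = q → t = q) →
      p ≠ q → d (p, q) = 0) := by
  subst hDd
  refine ⟨fun p q => ?_, fun p hp => ?_, fun p q hp hq hpq => ?_⟩
  · let _ := semilatticeOrder hidem
    have h := mem_of_sum_upset_mem (Int.castAddHom ℂ).range d (fun x => ?_) (p, q)
    · obtain ⟨k, hk⟩ := h
      exact ⟨k, hk.symm⟩
    · refine ⟨if x.1 = x.2 then 1 else 0, ?_⟩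
      trans if x.1 = x.2 then 1 else 0
      · simp
      · rw [← hD.sum_upset_coeff hidem x.1 x.2]
        exact Finset.sum_congr (by ext; simp only [Finset.mem_filter]; rfl) fun _ _ => rfl
  · simp [hD.coeff_of_maximal hidem hp hp]
  · simp [hD.coeff_of_maximal hidem hp hq, hpq]
end

section
/- Let S be a finite semilattice with unique diagonal D = ∑_{(s,t)∈S×S} d(s,t) δ_s ⊗ δ_t. Then for every p ∈ S, d(p,p) = ∑_{r ≥ p} μ(p,r)², where μ is the Möbius function of the poset (S, ≤); in particular d(p,p) ≥ 1. -/
open scoped TensorProduct Classical ComplexOrder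

/-- The bilinear evaluation `a ⊗ b ↦ φ a * ψ b` attached to two characters. -/
noncomputable def tensorEval {A : Type*} [NonUnitalSemiring A] [Module ℂ A]
    (φ ψ : A →ₙₐ[ℂ] ℂ) : A ⊗[ℂ] A →ₗ[ℂ] ℂ :=
  LinearMap.mul' ℂ ℂ ∘ₗ TensorProduct.map (φ : A →ₗ[ℂ] ℂ) (ψ : A →ₗ[ℂ] ℂ)

@[simp]
theorem tensorEval_tmul {A : Type*} [NonUnitalSemiring A] [Module ℂ A]
    (φ ψ : A →ₙₐ[ℂ] ℂ) (a b : A) : tensorEval φ ψ (a ⊗ₜ[ℂ] b) = φ a * ψ b := by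
  simp [tensorEval]

theorem IsDiagonal.mul_tensorEval {A : Type*} [NonUnitalSemiring A] [Module ℂ A]
    [SMulCommClass ℂ A A] [IsScalarTower ℂ A A] {D : A ⊗[ℂ] A} (hD : IsDiagonal D)
    (φ ψ : A →ₙₐ[ℂ] ℂ) (a : A) :
    φ a * tensorEval φ ψ D = ψ a * tensorEval φ ψ D := by
  have hleft : tensorEval φ ψ ∘ₗ TensorProduct.map (LinearMap.mulLeft ℂ a) LinearMap.id =
      φ a • tensorEval φ ψ := by
    refine TensorProduct.ext' fun b c => ?_
    simp [mul_assoc]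
  have hright : tensorEval φ ψ ∘ₗ TensorProduct.map LinearMap.id (LinearMap.mulRight ℂ a) =
      ψ a • tensorEval φ ψ := by
    refine TensorProduct.ext' fun b c => ?_
    simp [mul_comm, mul_left_comm]
  have h := congrArg (tensorEval φ ψ) (hD.2 a)
  rw [← LinearMap.comp_apply, ← LinearMap.comp_apply, hleft, hright] at h
  simpa using h

theorem IsDiagonal.tensorEval_self {A : Type*} [NonUnitalSemiring A] [Module ℂ A]
    [SMulCommClass ℂ A A] [IsScalarTower ℂ A A] {D : A ⊗[ℂ] A} (hD : IsDiagonal D)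
    (φ : A →ₙₐ[ℂ] ℂ) {a : A} (ha : φ a = 1) : tensorEval φ φ D = 1 := by
  have hmul : tensorEval φ φ = (φ : A →ₗ[ℂ] ℂ) ∘ₗ LinearMap.mul' ℂ A :=
    TensorProduct.ext' fun b c => by simp
  have h := congrArg φ (hD.1 a).1
  rw [map_mul, ha, one_mul] at h
  simpa [hmul] using h

/-- The character of `ℓ¹(S)` induced by the indicator function of the filter `{s | u ≤ s}`. -/
noncomputable def filterCharacter {S : Type*} [CommSemigroup S] (hidem : ∀ s : S, s * s = s)
    (u : S) : MonoidAlgebra ℂ S →ₙₐ[ℂ] ℂ :=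
  MonoidAlgebra.liftMagma ℂ
    { toFun := fun s => if u * s = u then 1 else 0
      map_mul' := fun s t => by
        have h : u * (s * t) = u ↔ u * s = u ∧ u * t = u := by
          refine ⟨fun h => ⟨?_, ?_⟩, fun h => by rw [← mul_assoc, h.1, h.2]⟩
          · calc u * s = u * (s * t) * s := by rw [h]
              _ = u * (s * s * t) := by simp only [mul_comm, mul_left_comm]
              _ = u := by rw [hidem, h]
          · calc u * t = u * (s * t) * t := by rw [h]
              _ = u * (s * (t * t)) := by simp only [mul_assoc]
              _ = u := by rw [hidem, h]
        by_cases hs : u * s = u <;> by_cases ht : u * t = u <;> simp [h, hs, ht] }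

@[simp]
theorem filterCharacter_single {S : Type*} [CommSemigroup S] (hidem : ∀ s : S, s * s = s)
    (u s : S) : filterCharacter hidem u (MonoidAlgebra.single s 1) = if u * s = u then 1 else 0 := by
  simp [filterCharacter]

theorem IsDiagonal.tensorEval_filterCharacter {S : Type*} [CommSemigroup S]
    (hidem : ∀ s : S, s * s = s) {D : MonoidAlgebra ℂ S ⊗[ℂ] MonoidAlgebra ℂ S}
    (hD : IsDiagonal D) (u v : S) :
    tensorEval (filterCharacter hidem u) (filterCharacter hidem v) D =
      if u = v then 1 else 0 := by
  split_ifs with huv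
  · subst huv
    exact hD.tensorEval_self _ (a := MonoidAlgebra.single u 1) (by simp [hidem])
  · by_contra hne
    have hu := mul_right_cancel₀ hne (hD.mul_tensorEval (filterCharacter hidem u)
      (filterCharacter hidem v) (MonoidAlgebra.single u 1))
    have hv := mul_right_cancel₀ hne (hD.mul_tensorEval (filterCharacter hidem u)
      (filterCharacter hidem v) (MonoidAlgebra.single v 1))
    have hvu : v * u = v := by simpa [hidem] using hu
    have huv' : u * v = u := by simpa [hidem] using hv
    exact huv (by rw [← huv', mul_comm, hvu])

/-- **Lemma (diagonal entries via the Möbius function).**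
Let `S` be a finite semilattice (ordered by `s ≤ t ↔ s * t = s`), let
`D = ∑_{(s,t)} d(s,t) δ_s ⊗ δ_t` be the (unique) diagonal of `ℓ¹(S)`, and let
`μ` be the Möbius function of the poset `(S, ≤)` (characterised by
`μ(s,s) = 1`, `∑_{t ≤ r ≤ s} μ(t,r) = 0` for `t < s`, and `μ(t,s) = 0` unless
`t ≤ s`).  Then `d(p,p) = ∑_{r ≥ p} μ(p,r)²` for every `p ∈ S`; in particular
`d(p,p) ≥ 1`. -/
theorem diagonal_entry_moebius (S : Type) [Fintype S] [Nonempty S]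
    [CommSemigroup S] (hidem : ∀ s : S, s * s = s)
    (d : S × S → ℂ)
    (D : MonoidAlgebra ℂ S ⊗[ℂ] MonoidAlgebra ℂ S)
    (hD : IsDiagonal D)
    (hDd : D = ∑ q : S × S,
        d q • (MonoidAlgebra.single q.1 (1 : ℂ) ⊗ₜ[ℂ] MonoidAlgebra.single q.2 (1 : ℂ)))
    (μ : S → S → ℤ)
    (hμ_refl : ∀ s : S, μ s s = 1)
    (hμ_sum : ∀ t s : S, t * s = t → t ≠ s →
        ∑ r ∈ Finset.univ.filter fun r : S => t * r = t ∧ r * s = r, μ t r = 0)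
    (hμ_zero : ∀ t s : S, ¬ t * s = t → μ t s = 0) :
    ∀ p : S,
      (d (p, p) = ∑ r ∈ Finset.univ.filter fun r : S => p * r = p, ((μ p r : ℂ)) ^ 2) ∧
      (1 : ℂ) ≤ d (p, p) := by
  intro p
  have hentry : d (p, p) =
      ∑ r ∈ Finset.univ.filter fun r : S => p * r = p, ((μ p r : ℂ)) ^ 2 := by
    let Z : Matrix S S ℂ := .of fun u s => if u * s = u then 1 else 0
    let M : Matrix S S ℂ := .of fun u s => (μ u s : ℂ)
    let E : Matrix S S ℂ := .of fun s t => d (s, t)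
    have hMZ : M * Z = 1 := by
      ext t s
      have hsum : ∑ r ∈ Finset.univ.filter (fun r : S => t * r = t ∧ r * s = r), μ t r =
          if t = s then 1 else 0 := by
        split_ifs with hts
        · subst hts
          have hfilter : (Finset.univ.filter fun r : S => t * r = t ∧ r * t = r) = {t} := by
            ext r
            simp only [Finset.mem_filter, Finset.mem_univ, true_and, Finset.mem_singleton]
            refine ⟨fun h => ?_, fun h => by simp [h, hidem]⟩
            rw [← h.2, mul_comm, h.1]
          rw [hfilter, Finset.sum_singleton, hμ_refl]
        · by_cases hle : t * s = t
          · exact hμ_sum t s hle hts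
          · refine Finset.sum_eq_zero fun r hr => absurd ?_ hle
            obtain ⟨h₁, h₂⟩ := (Finset.mem_filter.1 hr).2
            calc t * s = t * r * s := by rw [h₁]
              _ = t := by rw [mul_assoc, h₂, h₁]
      have hcast := congrArg (Int.cast : ℤ → ℂ) hsum
      rw [Matrix.one_apply, Matrix.mul_apply]
      push_cast at hcast
      rw [← hcast, Finset.sum_filter]
      refine Finset.sum_congr rfl fun r _ => ?_
      by_cases h₁ : t * r = t
      · simp [M, Z, h₁]
      · simp [M, Z, h₁, hμ_zero t r h₁]
    have hZEZ : Z * E * Z.transpose = 1 := by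
      ext u v
      rw [Matrix.one_apply, ← hD.tensorEval_filterCharacter hidem u v, hDd, map_sum,
        Fintype.sum_prod_type_right]
      simp only [Matrix.mul_apply, Finset.sum_mul, Matrix.transpose_apply]
      refine Finset.sum_congr rfl fun t _ => Finset.sum_congr rfl fun s _ => ?_
      simp only [map_smul, tensorEval_tmul, filterCharacter_single, smul_eq_mul, Z, E,
        Matrix.of_apply]
      ring
    have hZM : Z.transpose * M.transpose = 1 := by
      rw [← Matrix.transpose_mul, hMZ, Matrix.transpose_one]
    have hE : E = M * M.transpose :=
      calc E = (M * Z) * E * (Z.transpose * M.transpose) := by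
            rw [hMZ, hZM, Matrix.one_mul, Matrix.mul_one]
        _ = M * (Z * E * Z.transpose) * M.transpose := by simp only [Matrix.mul_assoc]
        _ = M * M.transpose := by rw [hZEZ, Matrix.mul_one]
    have hpp : E p p = (M * M.transpose) p p := by rw [← hE]
    rw [Matrix.mul_apply] at hpp
    rw [Finset.sum_filter]
    refine hpp.trans (Finset.sum_congr rfl fun r _ => ?_)
    split_ifs with h
    · simp [M, sq]
    · simp [M, hμ_zero p r h]
  refine ⟨hentry, ?_⟩
  have hone : (1 : ℤ) ≤ ∑ r ∈ Finset.univ.filter fun r : S => p * r = p, μ p r ^ 2 := by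
    have hp : p ∈ Finset.univ.filter fun r : S => p * r = p := by simp [hidem]
    have h := Finset.single_le_sum (f := fun r => μ p r ^ 2) (fun r _ => sq_nonneg _) hp
    simpa only [hμ_refl, one_pow] using h
  rw [hentry]
  exact_mod_cast hone
end
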